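/- arXiv:2103.01727 — 2 statements merged into one kernel-verified Lean document; each statement's English description precedes it below -/
import Mathlib

section
/- Let {γ_n} be a [0,1]-valued sequence with γ_n → γ ∈ [0,1] and |γ_n - γ| = O(1/n). Let φ_{n,α}(t) = Σ_{j=1+⌊(n-1)α⌋}^{n} C(n,j) t^j (1-t)^{n-j}. Then for (t,s) ∈ (0,1)×(0,1), the ratio φ'_{n,γ_n}(t)/φ'_{n,γ_n}(s) is bounded above by C(t,s) · [ (t/s)^γ ((1-t)/(1-s))^{1-γ} ]^{n-1}, where C(t,s) is a positive constant independent of n. -/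
open MeasureTheory Set Filter

noncomputable def dphi (n : ℕ) (α : ℝ) (t : ℝ) : ℝ :=
  (n : ℝ) * ((n - 1).choose ((⌊((n : ℝ) - 1) * α⌋).toNat) : ℝ) *
    t ^ ((⌊((n : ℝ) - 1) * α⌋).toNat) * (1 - t) ^ (n - 1 - (⌊((n : ℝ) - 1) * α⌋).toNat)

/-- If `γ_n → γ ∈ [0,1]` with `|γ_n - γ| = O(1/n)`, then for `t, s ∈ (0,1)` there is a
constant `C = C(t,s) > 0`, independent of `n`, such that
`φ'_{n,γ_n}(t)/φ'_{n,γ_n}(s) ≤ C · [(t/s)^γ ((1-t)/(1-s))^{1-γ}]^{n-1}`. -/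
theorem stmt5 (γ : ℝ) (hγ : γ ∈ Set.Icc (0:ℝ) 1)
    (γseq : ℕ → ℝ) (hseq : ∀ n, γseq n ∈ Set.Icc (0:ℝ) 1)
    (htend : Tendsto γseq atTop (nhds γ))
    (hrate : ∃ K > (0:ℝ), ∃ N : ℕ, ∀ n ≥ N, |γseq n - γ| ≤ K / n)
    (t s : ℝ) (ht : t ∈ Set.Ioo (0:ℝ) 1) (hs : s ∈ Set.Ioo (0:ℝ) 1) :
    ∃ C > (0:ℝ), ∀ n : ℕ, 1 ≤ n →
      dphi n (γseq n) t / dphi n (γseq n) s ≤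
        C * ((t / s) ^ γ * ((1 - t) / (1 - s)) ^ (1 - γ)) ^ (n - 1) := by
  obtain ⟨K, hK, N, hN⟩ := hrate
  obtain ⟨ht0, ht1⟩ := ht
  obtain ⟨hs0, hs1⟩ := hs
  have ht1' : 0 < 1 - t := by linarith
  have hs1' : 0 < 1 - s := by linarith
  have ha : 0 < t / s := div_pos ht0 hs0
  have hb : 0 < (1 - t) / (1 - s) := div_pos ht1' hs1'
  refine ⟨Real.exp ((1 + K + N) * |Real.log (t / s) - Real.log ((1 - t) / (1 - s))|),
    Real.exp_pos _, ?_⟩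
  intro n hn
  obtain ⟨m, rfl⟩ : ∃ m, n = m + 1 := ⟨n - 1, by omega⟩
  obtain ⟨hg0, hg1⟩ := hseq (m + 1)
  have hrate' := hN (m + 1)
  generalize γseq (m + 1) = g at hg0 hg1 hrate' ⊢
  have hm0 : (0:ℝ) ≤ m := Nat.cast_nonneg m
  have hfl : (((m + 1 : ℕ) : ℝ) - 1) * g = m * g := by push_cast; ring
  unfold dphi
  rw [hfl, Nat.add_sub_cancel]
  have hf0 : 0 ≤ ⌊(m:ℝ) * g⌋ := Int.floor_nonneg.mpr (by positivity)
  obtain ⟨k, hk⟩ := Int.eq_ofNat_of_zero_le hf0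
  have hk1 : (k:ℝ) ≤ m * g := by
    have := Int.floor_le ((m:ℝ) * g)
    rw [hk] at this
    exact_mod_cast this
  have hk2 : (m:ℝ) * g < k + 1 := by
    have := Int.lt_floor_add_one ((m:ℝ) * g)
    rw [hk] at this
    exact_mod_cast this
  rw [hk, Int.toNat_natCast]
  have hkm : k ≤ m := by
    have : (k:ℝ) ≤ m := by nlinarith
    exact_mod_cast this
  have hch : (0:ℝ) < (m.choose k : ℝ) := by exact_mod_cast Nat.choose_pos hkm
  have hratio : ((m + 1 : ℕ) : ℝ) * (m.choose k : ℝ) * t ^ k * (1 - t) ^ (m - k) /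
      (((m + 1 : ℕ) : ℝ) * (m.choose k : ℝ) * s ^ k * (1 - s) ^ (m - k)) =
      (t / s) ^ k * ((1 - t) / (1 - s)) ^ (m - k) := by
    have : ((m + 1 : ℕ) : ℝ) ≠ 0 := by positivity
    rw [div_pow, div_pow]
    field_simp
  rw [hratio]
  generalize t / s = a at *
  generalize (1 - t) / (1 - s) = b at *
  have hdist : |(k:ℝ) - m * γ| ≤ 1 + K + N := by
    have h2 : |(m:ℝ) * (g - γ)| ≤ K + N := by
      rw [abs_mul, abs_of_nonneg hm0]
      by_cases h : N ≤ m + 1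
      · have h3 := hrate' h
        have hp : (0:ℝ) < ((m + 1 : ℕ) : ℝ) := by positivity
        rw [le_div_iff₀ hp] at h3
        push_cast at h3
        have := abs_nonneg (g - γ)
        have : (0:ℝ) ≤ N := Nat.cast_nonneg N
        nlinarith
      · have h3 : (m:ℝ) ≤ N := by exact_mod_cast (by omega : m ≤ N)
        have h4 : |g - γ| ≤ 1 := by
          rw [abs_le]; constructor <;> linarith [hγ.1, hγ.2]
        nlinarith [abs_nonneg (g - γ)]
    rw [abs_le] at h2 ⊢
    constructor <;> nlinarith [h2.1, h2.2]
  have hL : a ^ k * b ^ (m - k) =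
      Real.exp (k * Real.log a + ((m:ℝ) - k) * Real.log b) := by
    rw [Real.exp_add, ← Nat.cast_sub hkm, Real.exp_nat_mul, Real.exp_nat_mul,
      Real.exp_log ha, Real.exp_log hb]
  have hR : (a ^ γ * b ^ (1 - γ)) ^ m =
      Real.exp (m * (Real.log a * γ + Real.log b * (1 - γ))) := by
    rw [Real.exp_nat_mul, Real.exp_add, Real.rpow_def_of_pos ha, Real.rpow_def_of_pos hb]
  rw [hL, hR, ← Real.exp_add, Real.exp_le_exp]
  have h5 : ((k:ℝ) - m * γ) * (Real.log a - Real.log b) ≤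
      (1 + K + N) * |Real.log a - Real.log b| := by
    refine (le_abs_self _).trans ?_
    rw [abs_mul]
    exact mul_le_mul_of_nonneg_right hdist (abs_nonneg _)
  linarith
end

section
/- Let γ_n → γ ∈ (0,1) with |γ_n−γ| = O(1/n) and let φ'_{n,α}(u) = n·C(n−1,⌊(n−1)α⌋)·u^{⌊(n−1)α⌋}(1−u)^{n−1−⌊(n−1)α⌋}. Then lim_{n→∞} φ'_{n,γ_n}(u) = 0 for every u ∈ [0,1] with u ≠ γ, and lim_{n→∞} φ'_{n,γ_n}(γ) = ∞. -/
open MeasureTheory Set Filter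

lemma aux_floor (γ : ℝ) (hγ : γ ∈ Set.Ioo (0:ℝ) 1)
    (γseq : ℕ → ℝ) (hseq : ∀ n, γseq n ∈ Set.Icc (0:ℝ) 1)
    (hrate : ∃ K > (0:ℝ), ∃ N : ℕ, ∀ n ≥ N, |γseq n - γ| ≤ K / n) :
    ∃ C > (0:ℝ), ∀ᶠ m : ℕ in atTop, ∃ k : ℕ, 1 ≤ k ∧ k < m ∧ |(k:ℝ) - m * γ| ≤ C ∧
      ∀ u, dphi (m+1) (γseq (m+1)) u =
        ((m:ℝ)+1) * ((m.choose k : ℝ) * u ^ k * (1-u)^(m-k)) := by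
  obtain ⟨K, hK, N, hN⟩ := hrate
  obtain ⟨h0, h1⟩ := hγ
  refine ⟨K + 1, by linarith, ?_⟩
  have e1 : ∀ᶠ m : ℕ in atTop, K + 2 ≤ (m:ℝ) * γ :=
    (tendsto_natCast_atTop_atTop.atTop_mul_const h0).eventually_ge_atTop _
  have e2 : ∀ᶠ m : ℕ in atTop, K + 2 ≤ (m:ℝ) * (1 - γ) :=
    (tendsto_natCast_atTop_atTop.atTop_mul_const (by linarith)).eventually_ge_atTop _
  filter_upwards [e1, e2, eventually_ge_atTop N] with m h1m h2m hm
  obtain ⟨g0, g1⟩ := hseq (m+1)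
  have hr := hN (m+1) (by omega)
  set g := γseq (m+1) with hg
  have hm0 : (0:ℝ) ≤ m := Nat.cast_nonneg m
  have hfl : 0 ≤ ⌊(m:ℝ) * g⌋ := Int.floor_nonneg.2 (by positivity)
  have hkc : (((⌊(m:ℝ) * g⌋).toNat : ℕ) : ℝ) = (⌊(m:ℝ) * g⌋ : ℝ) := by
    have : (((⌊(m:ℝ) * g⌋).toNat : ℕ) : ℤ) = ⌊(m:ℝ) * g⌋ := Int.toNat_of_nonneg hfl
    exact_mod_cast this
  have b1 := Int.floor_le ((m:ℝ) * g)
  have b2 := Int.lt_floor_add_one ((m:ℝ) * g)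
  have hd : |(m:ℝ) * g - m * γ| ≤ K := by
    rw [← mul_sub, abs_mul, abs_of_nonneg hm0]
    calc (m:ℝ) * |g - γ| ≤ m * (K / ((m+1 : ℕ):ℝ)) := by gcongr
      _ ≤ K := by
        push_cast
        rw [← mul_div_assoc, div_le_iff₀ (by positivity)]
        nlinarith
  rw [abs_le] at hd
  have hc : |(((⌊(m:ℝ) * g⌋).toNat : ℕ) : ℝ) - m * γ| ≤ K + 1 := by
    rw [hkc, abs_le]; constructor <;> linarith [hd.1, hd.2]
  refine ⟨(⌊(m:ℝ) * g⌋).toNat, ?_, ?_, hc, ?_⟩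
  · rw [abs_le] at hc
    have : (1:ℝ) ≤ (((⌊(m:ℝ) * g⌋).toNat : ℕ) : ℝ) := by linarith [hc.1]
    exact_mod_cast this
  · rw [abs_le] at hc
    have : (((⌊(m:ℝ) * g⌋).toNat : ℕ) : ℝ) < m := by linarith [hc.2]
    exact_mod_cast this
  · intro u
    unfold dphi
    have : ((m + 1 : ℕ) : ℝ) - 1 = m := by push_cast; ring
    rw [this, Nat.add_sub_cancel]
    push_cast
    ring

lemma aux_le_one (m k : ℕ) (h : k ≤ m) (v : ℝ) (h0 : 0 ≤ v) (h1 : v ≤ 1) :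
    (m.choose k : ℝ) * v ^ k * (1-v)^(m-k) ≤ 1 := by
  have hs := add_pow v (1-v) m
  have : (v + (1-v))^m = 1 := by simp
  rw [this] at hs
  have h1' : 0 ≤ 1 - v := by linarith
  have := Finset.single_le_sum (f := fun j => v ^ j * (1-v)^(m-j) * (m.choose j : ℝ))
    (s := Finset.range (m+1)) (fun j _ => by positivity) (Finset.mem_range.2 (by omega : k < m+1))
  calc _ = v ^ k * (1-v)^(m-k) * (m.choose k : ℝ) := by ring
    _ ≤ _ := this
    _ = 1 := hs.symm

lemma aux_fact (k m : ℕ) (hk : 1 ≤ k) (hkm : k ≤ m) :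
    (k.factorial : ℝ) ≤ Stirling.stirlingSeq 1 * √(2*m) * ((k:ℝ) / Real.exp 1)^k := by
  have h : Stirling.stirlingSeq k ≤ Stirling.stirlingSeq 1 := by
    obtain ⟨j, rfl⟩ : ∃ j, k = j + 1 := ⟨k-1, by omega⟩
    exact Stirling.stirlingSeq'_antitone (Nat.zero_le j)
  have hk0 : (0:ℝ) < k := by exact_mod_cast hk
  unfold Stirling.stirlingSeq at h ⊢
  rw [div_le_iff₀ (by positivity)] at h
  refine h.trans ?_
  rw [← mul_assoc]
  have : (k:ℝ) ≤ m := by exact_mod_cast hkm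
  gcongr

lemma aux_pow (k m : ℕ) (hk : 1 ≤ k) (hkm : k ≤ m) (v C : ℝ) (hv : 0 < v)
    (h : |(k:ℝ) - m * v| ≤ C) :
    ((k:ℝ) / Real.exp 1)^k ≤ Real.exp (C / v) * v^k * ((m:ℝ)/Real.exp 1)^k := by
  have hk0 : (0:ℝ) < k := by exact_mod_cast hk
  have hkm' : (k:ℝ) ≤ m := by exact_mod_cast hkm
  have hm0 : (0:ℝ) < m := by linarith
  have hC : 0 ≤ C := (abs_nonneg _).trans h
  have h1 : (k:ℝ) / (m * v) ≤ Real.exp (C / (m * v)) := by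
    have h2 := Real.add_one_le_exp (C / (m * v))
    refine le_trans ?_ h2
    rw [div_add_one (by positivity)]
    gcongr
    linarith [(abs_le.1 h).2]
  have h3 : ((k:ℝ) / (m * v))^k ≤ Real.exp (C / v) := by
    calc _ ≤ (Real.exp (C / (m * v)))^k := by gcongr
      _ = Real.exp (k * (C / (m * v))) := by rw [← Real.exp_nat_mul]
      _ ≤ Real.exp (m * (C / (m * v))) := by gcongr
      _ = _ := by congr 1; field_simp
  calc ((k:ℝ) / Real.exp 1)^k = ((k:ℝ) / (m * v))^k * (v^k * ((m:ℝ)/Real.exp 1)^k) := by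
        rw [← mul_pow, ← mul_pow]; congr 1; field_simp
    _ ≤ Real.exp (C / v) * (v^k * ((m:ℝ)/Real.exp 1)^k) := by gcongr
    _ = _ := by ring

lemma aux_lower (γ C : ℝ) (h0 : 0 < γ) (h1 : γ < 1) : ∃ D > (0:ℝ), ∀ m k : ℕ, 1 ≤ k → k < m →
    |(k:ℝ) - m * γ| ≤ C → √m ≤ D * (m * ((m.choose k : ℝ) * γ ^ k * (1-γ)^(m-k))) := by
  have hE : 0 < Stirling.stirlingSeq 1 := Stirling.stirlingSeq'_pos 0
  set E := Stirling.stirlingSeq 1 with hEdef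
  have h1' : 0 < 1 - γ := by linarith
  refine ⟨2 * E^2 * Real.exp (C / γ) * Real.exp (C / (1-γ)), by positivity, ?_⟩
  intro m k hk hkm hC
  obtain ⟨l, rfl⟩ : ∃ l, m = k + l := ⟨m - k, by omega⟩
  rw [Nat.add_sub_cancel_left]
  set m := k + l with hm
  have hl : 1 ≤ l := by omega
  have hm0 : (0:ℝ) < m := by exact_mod_cast (by omega : 0 < m)
  have hC' : |(l:ℝ) - m * (1-γ)| ≤ C := by
    have : (l:ℝ) - m * (1-γ) = -((k:ℝ) - m * γ) := by rw [hm]; push_cast; ring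
    rw [this, abs_neg]; exact hC
  have f1 := aux_fact k m hk (by omega)
  have f2 := aux_fact l m hl (by omega)
  have p1 := aux_pow k m hk (by omega) γ C h0 hC
  have p2 := aux_pow l m hl (by omega) (1-γ) C h1' hC'
  have s := Stirling.le_factorial_stirling m
  have hfac : (m.choose k : ℝ) * k.factorial * l.factorial = m.factorial := by
    have := Nat.choose_mul_factorial_mul_factorial (n := m) (k := k) (by omega)
    rw [show m - k = l by omega] at this
    exact_mod_cast this
  rw [← hEdef] at f1 f2
  set x := (m:ℝ) / Real.exp 1 with hx
  have hx0 : 0 < x := by positivity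
  have s1 : √m * x^m ≤ m.factorial := by
    refine le_trans ?_ s
    gcongr
    nlinarith [Real.pi_gt_three]
  have q1 : (k.factorial:ℝ) ≤ E * √(2*m) * (Real.exp (C / γ) * γ^k * x^k) :=
    f1.trans (by gcongr)
  have q2 : (l.factorial:ℝ) ≤ E * √(2*m) * (Real.exp (C / (1-γ)) * (1-γ)^l * x^l) :=
    f2.trans (by gcongr)
  have hsq : √(2*(m:ℝ)) * √(2*(m:ℝ)) = 2 * m := Real.mul_self_sqrt (by positivity)
  have key : √m * x^m ≤ (2 * E^2 * Real.exp (C / γ) * Real.exp (C / (1-γ)) *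
      (m * ((m.choose k : ℝ) * γ ^ k * (1-γ)^l))) * x^m := by
    calc √m * x^m ≤ (m.choose k : ℝ) * k.factorial * l.factorial := by rw [hfac]; exact s1
      _ ≤ (m.choose k : ℝ) * (E * √(2*m) * (Real.exp (C / γ) * γ^k * x^k)) *
          (E * √(2*m) * (Real.exp (C / (1-γ)) * (1-γ)^l * x^l)) := by gcongr
      _ = (m.choose k : ℝ) * E^2 * (√(2*(m:ℝ)) * √(2*(m:ℝ))) * Real.exp (C / γ) *
          Real.exp (C / (1-γ)) * γ^k * (1-γ)^l * (x^k * x^l) := by ring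
      _ = _ := by rw [hsq, ← pow_add, ← hm]; ring
  exact le_of_mul_le_mul_right key (by positivity)

lemma aux_upper (γ C u : ℝ) (h0 : 0 < γ) (h1 : γ < 1) (u0 : 0 < u) (u1 : u < 1) (hu : u ≠ γ) :
    ∃ d > (0:ℝ), ∃ L : ℝ, ∀ m k : ℕ, k ≤ m → |(k:ℝ) - m * γ| ≤ C →
      (m.choose k : ℝ) * u ^ k * (1-u)^(m-k) ≤ Real.exp L * Real.exp (- d * m) := by
  have h1' : 0 < 1 - γ := by linarith
  have u1' : 0 < 1 - u := by linarith
  set a := u / γ with ha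
  set b := (1-u)/(1-γ) with hb
  have ha0 : 0 < a := by positivity
  have hb0 : 0 < b := by positivity
  have la : Real.log a < a - 1 := by
    refine Real.log_lt_sub_one_of_pos ha0 ?_
    rw [ha, Ne, div_eq_one_iff_eq h0.ne']; exact hu
  have lb : Real.log b ≤ b - 1 := Real.log_le_sub_one_of_pos hb0
  have ea : γ * a = u := by rw [ha]; field_simp
  have eb : (1-γ) * b = 1 - u := by rw [hb]; field_simp
  refine ⟨-(γ * Real.log a + (1-γ) * Real.log b), by nlinarith,
    C * |Real.log a - Real.log b|, ?_⟩
  intro m k hk hC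
  have e1 : (m.choose k : ℝ) * u ^ k * (1-u)^(m-k) =
      ((m.choose k : ℝ) * γ ^ k * (1-γ)^(m-k)) * (a^k * b^(m-k)) := by
    rw [← eb, mul_pow]; nth_rewrite 1 [← ea]; rw [mul_pow]; ring
  have e2 : a^k * b^(m-k) = Real.exp (k * Real.log a + (m-k) * Real.log b) := by
    rw [Real.exp_add, ← Nat.cast_sub hk, Real.exp_nat_mul, Real.exp_nat_mul, Real.exp_log ha0,
      Real.exp_log hb0]
  have e3 := aux_le_one m k hk γ h0.le h1.le
  calc _ ≤ 1 * (a^k * b^(m-k)) := by rw [e1]; gcongr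
    _ = Real.exp (k * Real.log a + (m-k) * Real.log b) := by rw [one_mul, e2]
    _ ≤ _ := by
      rw [← Real.exp_add]
      apply Real.exp_le_exp.2
      have : ((k:ℝ) - m * γ) * (Real.log a - Real.log b) ≤ C * |Real.log a - Real.log b| := by
        refine (le_abs_self _).trans ?_
        rw [abs_mul]; gcongr
      nlinarith

/-- If `γ_n → γ ∈ (0,1)` with `|γ_n − γ| = O(1/n)`, then `φ'_{n,γ_n}(u) → 0` for every
`u ∈ [0,1]` with `u ≠ γ`, and `φ'_{n,γ_n}(γ) → ∞`. -/
theorem stmt16 (γ : ℝ) (hγ : γ ∈ Set.Ioo (0:ℝ) 1)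
    (γseq : ℕ → ℝ) (hseq : ∀ n, γseq n ∈ Set.Icc (0:ℝ) 1)
    (htend : Tendsto γseq atTop (nhds γ))
    (hrate : ∃ K > (0:ℝ), ∃ N : ℕ, ∀ n ≥ N, |γseq n - γ| ≤ K / n) :
    (∀ u ∈ Set.Icc (0:ℝ) 1, u ≠ γ →
      Tendsto (fun n : ℕ => dphi n (γseq n) u) atTop (nhds 0)) ∧
    Tendsto (fun n : ℕ => dphi n (γseq n) γ) atTop atTop := by
  obtain ⟨C, hC, hev⟩ := aux_floor γ hγ γseq hseq hrate
  obtain ⟨h0, h1⟩ := hγ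
  constructor
  · intro u ⟨u0, u1⟩ hu
    rw [← tendsto_add_atTop_iff_nat 1]
    rcases u0.eq_or_lt with rfl | u0
    · refine tendsto_const_nhds.congr' ?_
      filter_upwards [hev] with m ⟨k, hk, hkm, _, he⟩
      rw [he, zero_pow (by omega)]; simp
    rcases u1.eq_or_lt with rfl | u1
    · refine tendsto_const_nhds.congr' ?_
      filter_upwards [hev] with m ⟨k, hk, hkm, _, he⟩
      rw [he, sub_self, zero_pow (by omega)]; simp
    obtain ⟨d, hd, L, hL⟩ := aux_upper γ C u h0 h1 u0 u1 hu
    have u1' : 0 < 1 - u := by linarith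
    have t1 : Tendsto (fun m : ℕ => ((m:ℝ)) * Real.exp (-d * m)) atTop (nhds 0) := by
      have := (tendsto_rpow_mul_exp_neg_mul_atTop_nhds_zero 1 d hd).comp
        (tendsto_natCast_atTop_atTop (R := ℝ))
      simpa [Function.comp_def] using this
    have t2 : Tendsto (fun m : ℕ => Real.exp (-d * m)) atTop (nhds 0) := by
      have := (tendsto_rpow_mul_exp_neg_mul_atTop_nhds_zero 0 d hd).comp
        (tendsto_natCast_atTop_atTop (R := ℝ))
      simpa [Function.comp_def] using this
    have t3 : Tendsto (fun m : ℕ => ((m:ℝ)+1) * (Real.exp L * Real.exp (-d * m))) atTop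
        (nhds 0) := by
      have := (t1.add t2).const_mul (Real.exp L)
      rw [add_zero, mul_zero] at this
      refine this.congr fun m => by ring
    refine tendsto_of_tendsto_of_tendsto_of_le_of_le' tendsto_const_nhds t3 ?_ ?_
    · filter_upwards [hev] with m ⟨k, hk, hkm, _, he⟩
      rw [he]; positivity
    · filter_upwards [hev] with m ⟨k, hk, hkm, hc, he⟩
      rw [he]
      have := hL m k hkm.le hc
      gcongr
  · rw [← tendsto_add_atTop_iff_nat 1]
    obtain ⟨D, hD, hDb⟩ := aux_lower γ C h0 h1
    have t : Tendsto (fun m : ℕ => √(m:ℝ) / D) atTop atTop :=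
      (Real.tendsto_sqrt_atTop.comp tendsto_natCast_atTop_atTop).atTop_div_const hD
    refine tendsto_atTop_mono' _ ?_ t
    filter_upwards [hev] with m ⟨k, hk, hkm, hc, he⟩
    rw [he, div_le_iff₀ hD]
    have h1' : 0 < 1 - γ := by linarith
    have hp : 0 ≤ (m.choose k : ℝ) * γ ^ k * (1-γ)^(m-k) := by positivity
    have := hDb m k hk hkm hc
    nlinarith [mul_nonneg hD.le hp]
end
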